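/- arXiv:math/9812147 — 4 statements merged into one kernel-verified Lean document; each statement's English description precedes it below -/
import Mathlib

section
/- Let a < b be reals, let f : ℝ → ℝ be continuous on [a, b], and let σ > 0 be real. For each integer m with m > 1 + σ define F_m(x) = (1/Γ(m−σ)) ∫ₐˣ (x−t)^{m−σ−1} f(t) dt. Then the Riemann–Liouville fractional derivative is independent of the choice of m: for all integers m₁, m₂ with m₂ ≥ m₁ > 1 + σ and all x in the open interval (a, b), the m₁-th iterated derivative of F_{m₁} at x equals the m₂-th iterated derivative of F_{m₂} at x. -/
open Set MeasureTheory Filter Topology in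
/-- For `p > 1`, the truncated power `u ↦ (max u 0) ^ p` is differentiable everywhere. -/
theorem hasDerivAt_max_zero_rpow {p : ℝ} (hp : 1 < p) (u : ℝ) :
    HasDerivAt (fun v : ℝ => (max v 0) ^ p) (p * (max u 0) ^ (p - 1)) u := by
  have hp0 : p ≠ 0 := by linarith
  have hp1 : p - 1 ≠ 0 := by linarith
  rcases lt_trichotomy u 0 with hu | rfl | hu
  · rw [max_eq_right hu.le, Real.zero_rpow hp1, mul_zero]
    refine (hasDerivAt_const u (0 : ℝ)).congr_of_eventuallyEq ?_
    filter_upwards [Iio_mem_nhds hu] with v hv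
    rw [max_eq_right (le_of_lt hv), Real.zero_rpow hp0]
  · rw [max_self, Real.zero_rpow hp1, mul_zero]
    have hr : HasDerivWithinAt (fun v : ℝ => (max v 0) ^ p) 0 (Ici 0) 0 := by
      have h := (Real.hasDerivAt_rpow_const (x := 0) (Or.inr hp.le)).hasDerivWithinAt (s := Ici 0)
      rw [Real.zero_rpow hp1, mul_zero] at h
      exact h.congr (fun v hv => by rw [max_eq_left hv]) (by rw [max_self])
    have hl : HasDerivWithinAt (fun v : ℝ => (max v 0) ^ p) 0 (Iic 0) 0 :=
      (hasDerivWithinAt_const (0 : ℝ) (Iic 0) (0 : ℝ)).congr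
        (fun v hv => by rw [max_eq_right hv, Real.zero_rpow hp0])
        (by rw [max_self, Real.zero_rpow hp0])
    have h := hl.union hr
    rwa [Iic_union_Ici, hasDerivWithinAt_univ] at h
  · rw [max_eq_left hu.le]
    refine (Real.hasDerivAt_rpow_const (Or.inl hu.ne')).congr_of_eventuallyEq ?_
    filter_upwards [Ioi_mem_nhds hu] with v hv
    rw [max_eq_left (le_of_lt hv)]

open Set MeasureTheory Filter Topology in
/-- The truncated power kernel extends the convolution integral on `[a, x]` to `[a, b]`. -/
theorem integral_sub_rpow_mul_eq_integral_max {a b x p : ℝ} {f : ℝ → ℝ}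
    (hf : ContinuousOn f (Icc a b)) (hp : 0 < p) (hx : x ∈ Ioo a b) :
    ∫ t in a..x, (x - t) ^ p * f t = ∫ t in a..b, (max (x - t) 0) ^ p * f t := by
  have hc : ContinuousOn (fun t => (max (x - t) 0) ^ p * f t) (Icc a b) :=
    (Continuous.rpow_const (by fun_prop) (fun _ => Or.inr hp.le)).continuousOn.mul hf
  have h₁ : IntervalIntegrable (fun t => (max (x - t) 0) ^ p * f t) volume a x :=
    (hc.mono (Icc_subset_Icc_right hx.2.le)).intervalIntegrable_of_Icc hx.1.le
  have h₂ : IntervalIntegrable (fun t => (max (x - t) 0) ^ p * f t) volume x b :=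
    (hc.mono (Icc_subset_Icc_left hx.1.le)).intervalIntegrable_of_Icc hx.2.le
  have hzero : ∫ t in x..b, (max (x - t) 0) ^ p * f t = 0 := by
    refine (intervalIntegral.integral_congr (g := fun _ => (0 : ℝ)) fun t ht => ?_).trans
      intervalIntegral.integral_zero
    rw [uIcc_of_le hx.2.le] at ht
    simp only [max_eq_right (sub_nonpos.2 ht.1), Real.zero_rpow hp.ne', zero_mul]
  rw [← intervalIntegral.integral_add_adjacent_intervals h₁ h₂, hzero, add_zero]
  refine intervalIntegral.integral_congr fun t ht => ?_
  rw [uIcc_of_le hx.1.le] at ht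
  simp only [max_eq_left (sub_nonneg.2 ht.2)]

open Set MeasureTheory Filter Topology in
/-- Differentiating the convolution of `f` with a power kernel lowers the exponent by one. -/
theorem hasDerivAt_integral_sub_rpow_mul {a b x p : ℝ} {f : ℝ → ℝ}
    (hf : ContinuousOn f (Icc a b)) (hp : 1 < p) (hx : x ∈ Ioo a b) :
    HasDerivAt (fun y => ∫ t in a..y, (y - t) ^ p * f t)
      (p * ∫ t in a..x, (x - t) ^ (p - 1) * f t) x := by
  have hab : a ≤ b := (hx.1.trans hx.2).le
  have hp0 : 0 < p := by linarith
  have hp1 : 0 < p - 1 := by linarith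
  have hK : ∀ {q : ℝ}, 0 < q → ∀ y : ℝ,
      ContinuousOn (fun t => (max (y - t) 0) ^ q * f t) (Icc a b) := fun hq y =>
    (Continuous.rpow_const (by fun_prop) (fun _ => Or.inr hq.le)).continuousOn.mul hf
  have hmeas : ∀ {g : ℝ → ℝ}, ContinuousOn g (Icc a b) →
      AEStronglyMeasurable g (volume.restrict (uIoc a b)) := fun hg => by
    rw [uIoc_of_le hab]
    exact (hg.mono Ioc_subset_Icc_self).aestronglyMeasurable measurableSet_Ioc
  have hderiv := (intervalIntegral.hasDerivAt_integral_of_dominated_loc_of_deriv_le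
    (μ := volume) (a := a) (b := b) (x₀ := x) (s := Ioo a b)
    (F := fun y t => (max (y - t) 0) ^ p * f t)
    (F' := fun y t => p * ((max (y - t) 0) ^ (p - 1) * f t))
    (bound := fun t => p * ((b - a) ^ (p - 1) * |f t|))
    (Ioo_mem_nhds hx.1 hx.2)
    (Eventually.of_forall fun y => hmeas (hK hp0 y))
    ((hK hp0 x).intervalIntegrable_of_Icc hab)
    (hmeas ((hK hp1 x).const_mul p))
    (Eventually.of_forall fun t ht y hy => by
      rw [uIoc_of_le hab] at ht
      have h0 : 0 ≤ max (y - t) 0 := le_max_right _ _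
      have hle : max (y - t) 0 ≤ b - a :=
        max_le (by linarith [hy.2, ht.1]) (by linarith)
      rw [Real.norm_eq_abs, abs_mul, abs_mul, abs_of_pos hp0,
        abs_of_nonneg (Real.rpow_nonneg h0 _)]
      gcongr)
    ((((continuousOn_const.mul hf.abs)).const_mul p).intervalIntegrable_of_Icc hab)
    (Eventually.of_forall fun t _ y _ => by
      have h := ((hasDerivAt_max_zero_rpow hp (y - t)).comp_sub_const y t).mul_const (f t)
      rwa [mul_assoc] at h)).2
  rw [intervalIntegral.integral_const_mul] at hderiv
  rw [integral_sub_rpow_mul_eq_integral_max hf hp1 hx]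
  refine hderiv.congr_of_eventuallyEq ?_
  filter_upwards [Ioo_mem_nhds hx.1 hx.2] with y hy
  exact integral_sub_rpow_mul_eq_integral_max hf hp0 hy


/-- The Riemann–Liouville fractional derivative `D^σ f = D^m (D^{−(m−σ)} f)` is independent
of the choice of the integer `m > 1 + σ`: for `F m x = (1/Γ(m−σ)) ∫ₐˣ (x−t)^{m−σ−1} f t dt`,
the `m₁`-th derivative of `F m₁` agrees with the `m₂`-th derivative of `F m₂` on `(a, b)`. -/
theorem riemannLiouville_deriv_indep_choice (a b : ℝ) (hab : a < b) (f : ℝ → ℝ)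
    (hf : ContinuousOn f (Set.Icc a b)) (σ : ℝ) (hσ : 0 < σ)
    (F : ℕ → ℝ → ℝ)
    (hF : ∀ (m : ℕ) (x : ℝ),
      F m x = (1 / Real.Gamma ((m : ℝ) - σ)) *
        ∫ t in a..x, (x - t) ^ ((m : ℝ) - σ - 1) * f t)
    (m₁ m₂ : ℕ) (hm₁ : 1 + σ < (m₁ : ℝ)) (hm₂ : m₁ ≤ m₂) :
    ∀ x ∈ Set.Ioo a b, iteratedDeriv m₁ (F m₁) x = iteratedDeriv m₂ (F m₂) x := by
  have hderiv : ∀ m : ℕ, 1 + σ < (m : ℝ) → ∀ x ∈ Set.Ioo a b,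
      deriv (F (m + 1)) x = F m x := by
    intro m hm x hx
    have hs : 0 < (m : ℝ) - σ := by linarith
    have hFm : F (m + 1) = fun y => (1 / Real.Gamma ((m : ℝ) - σ + 1)) *
        ∫ t in a..y, (y - t) ^ ((m : ℝ) - σ) * f t := by
      funext y
      rw [hF, Nat.cast_succ, show (m : ℝ) + 1 - σ - 1 = m - σ by ring,
        show (m : ℝ) + 1 - σ = m - σ + 1 by ring]
    have hd := (hasDerivAt_integral_sub_rpow_mul hf (p := (m : ℝ) - σ) (by linarith) hx).const_mul
      (1 / Real.Gamma ((m : ℝ) - σ + 1))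
    rw [hFm, hd.deriv, hF, Real.Gamma_add_one hs.ne']
    have hG := (Real.Gamma_pos_of_pos hs).ne'
    field_simp
  intro x hx
  induction m₂, hm₂ using Nat.le_induction with
  | base => rfl
  | succ n hn ih =>
    have hn' : (m₁ : ℝ) ≤ n := by exact_mod_cast hn
    have hev : F n =ᶠ[nhds x] deriv (F (n + 1)) := by
      filter_upwards [Ioo_mem_nhds hx.1 hx.2] with y hy
      exact (hderiv n (by linarith) y hy).symm
    rw [ih, iteratedDeriv_succ']
    exact hev.iteratedDeriv_eq n
end

section
/- For all reals ρ > 0 and x > 0, (1/Γ(ρ)) ∫₀ˣ (x−t)^{ρ−1} log t dt equals the limit as ε → 0⁺ of (1/ε) · ( Γ(1+ε)·x^{ρ+ε}/Γ(1+ε+ρ) − x^ρ/Γ(1+ρ) ). -/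
open Filter

/-- The real Beta integral on `[0, x]`, as a complex number. -/
lemma ofReal_integral_sub_rpow_mul_rpow {ρ x s : ℝ} (hρ : 0 < ρ) (hx : 0 < x) (hs : -1 < s) :
    ((∫ t in (0 : ℝ)..x, (x - t) ^ (ρ - 1) * t ^ s : ℝ) : ℂ) =
      ((Real.Gamma ρ * (Real.Gamma (1 + s) * x ^ (ρ + s) / Real.Gamma (1 + s + ρ)) : ℝ) : ℂ) := by
  have h := Complex.betaIntegral_scaled ((1 + s : ℝ) : ℂ) (ρ : ℂ) hx
  rw [Complex.betaIntegral_eq_Gamma_mul_div _ _ (by simp; linarith) (by simpa)] at h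
  have hrhs : (x : ℂ) ^ (((1 + s : ℝ) : ℂ) + ρ - 1) = ((x ^ (ρ + s) : ℝ) : ℂ) := by
    rw [Complex.ofReal_cpow hx.le]
    congr 1
    push_cast
    ring
  rw [hrhs, ← Complex.ofReal_add, Complex.Gamma_ofReal, Complex.Gamma_ofReal,
    Complex.Gamma_ofReal] at h
  rw [← intervalIntegral.integral_ofReal]
  refine Eq.trans ?_ (h.trans (by push_cast; ring))
  refine intervalIntegral.integral_congr fun t ht => ?_
  rw [Set.uIcc_of_le hx.le] at ht
  have h1 : 0 ≤ x - t := sub_nonneg.2 ht.2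
  simp only [Complex.ofReal_mul, Complex.ofReal_cpow h1, Complex.ofReal_cpow ht.1]
  push_cast
  rw [mul_comm, add_sub_cancel_left]

/-- The Beta integral on `[0, x]`. -/
lemma integral_sub_rpow_mul_rpow {ρ x s : ℝ} (hρ : 0 < ρ) (hx : 0 < x) (hs : -1 < s) :
    ∫ t in (0 : ℝ)..x, (x - t) ^ (ρ - 1) * t ^ s =
      Real.Gamma ρ * (Real.Gamma (1 + s) * x ^ (ρ + s) / Real.Gamma (1 + s + ρ)) :=
  Complex.ofReal_injective (ofReal_integral_sub_rpow_mul_rpow hρ hx hs)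

lemma intervalIntegrable_sub_rpow_mul_rpow {ρ x s : ℝ} (hρ : 0 < ρ) (hx : 0 < x) (hs : -1 < s) :
    IntervalIntegrable (fun t => (x - t) ^ (ρ - 1) * t ^ s) MeasureTheory.volume 0 x := by
  refine intervalIntegral.intervalIntegrable_of_integral_ne_zero ?_
  rw [integral_sub_rpow_mul_rpow hρ hx hs]
  have h1 := Real.Gamma_pos_of_pos hρ
  have h2 := Real.Gamma_pos_of_pos (show 0 < 1 + s by linarith)
  have h3 := Real.Gamma_pos_of_pos (show 0 < 1 + s + ρ by linarith)
  positivity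

lemma abs_rpow_mul_log_le {t s δ : ℝ} (ht : 0 < t) (hδ : 0 < δ) (hs : |s| ≤ δ) :
    |t ^ s * Real.log t| ≤ (t ^ (2 * δ) + 2 * t ^ (0 : ℝ) + t ^ (-(2 * δ))) / δ := by
  have hp := Real.rpow_pos_of_pos ht δ
  have hn := Real.rpow_pos_of_pos ht (-δ)
  obtain ⟨hs1, hs2⟩ := abs_le.1 hs
  have hpow : t ^ s ≤ t ^ δ + t ^ (-δ) := by
    rcases le_total t 1 with h | h
    · linarith [Real.rpow_le_rpow_of_exponent_ge ht h hs1]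
    · linarith [Real.rpow_le_rpow_of_exponent_le h hs2]
  have hlog : |Real.log t| ≤ (t ^ δ + t ^ (-δ)) / δ := by
    have h1 := Real.log_le_rpow_div ht.le hδ
    have h2 := Real.log_le_rpow_div (inv_pos.2 ht).le hδ
    rw [Real.log_inv, Real.inv_rpow ht.le, ← Real.rpow_neg ht.le] at h2
    rw [add_div, abs_le]
    constructor <;> linarith [div_pos hp hδ, div_pos hn hδ]
  calc |t ^ s * Real.log t| = t ^ s * |Real.log t| := by
        rw [abs_mul, abs_of_pos (Real.rpow_pos_of_pos ht s)]
    _ ≤ (t ^ δ + t ^ (-δ)) * ((t ^ δ + t ^ (-δ)) / δ) := by gcongr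
    _ = _ := by
        have e1 : t ^ (2 * δ) = t ^ δ * t ^ δ := by rw [← Real.rpow_add ht]; ring_nf
        have e2 : t ^ (-(2 * δ)) = t ^ (-δ) * t ^ (-δ) := by rw [← Real.rpow_add ht]; ring_nf
        have e3 : t ^ (0 : ℝ) = t ^ δ * t ^ (-δ) := by rw [← Real.rpow_add ht]; ring_nf
        rw [e1, e2, e3]
        ring

/-- Differentiating the Beta integral on `[0, x]` under the integral sign. -/
lemma hasDerivAt_integral_sub_rpow_mul_rpow {ρ x : ℝ} (hρ : 0 < ρ) (hx : 0 < x) :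
    HasDerivAt (fun s : ℝ => ∫ t in (0 : ℝ)..x, (x - t) ^ (ρ - 1) * t ^ s)
      (∫ t in (0 : ℝ)..x, (x - t) ^ (ρ - 1) * Real.log t) 0 := by
  have key := (intervalIntegral.hasDerivAt_integral_of_dominated_loc_of_deriv_le
    (μ := MeasureTheory.volume) (a := 0) (b := x) (x₀ := (0 : ℝ))
    (F := fun s t => (x - t) ^ (ρ - 1) * t ^ s)
    (F' := fun s t => (x - t) ^ (ρ - 1) * (t ^ s * Real.log t))
    (bound := fun t => (x - t) ^ (ρ - 1) *
      ((t ^ (2 * (1 / 4) : ℝ) + 2 * t ^ (0 : ℝ) + t ^ (-(2 * (1 / 4)) : ℝ)) / (1 / 4)))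
    (Metric.ball_mem_nhds 0 (by norm_num : (0 : ℝ) < 1 / 4))
    (Eventually.of_forall fun s => by
      refine Measurable.aestronglyMeasurable ?_
      fun_prop)
    (intervalIntegrable_sub_rpow_mul_rpow hρ hx (by norm_num))
    (by
      refine Measurable.aestronglyMeasurable ?_
      fun_prop)
    (Eventually.of_forall fun t ht s hs => by
      rw [Set.uIoc_of_le hx.le] at ht
      have h0 : 0 ≤ (x - t) ^ (ρ - 1) := Real.rpow_nonneg (sub_nonneg.2 ht.2) _
      rw [norm_mul, Real.norm_of_nonneg h0]
      refine mul_le_mul_of_nonneg_left ?_ h0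
      exact abs_rpow_mul_log_le ht.1 (by norm_num) (by simpa using (mem_ball_zero_iff.1 hs).le))
    (by
      have h1 := intervalIntegrable_sub_rpow_mul_rpow hρ hx
        (show (-1 : ℝ) < 2 * (1 / 4) by norm_num)
      have h2 := intervalIntegrable_sub_rpow_mul_rpow hρ hx (show (-1 : ℝ) < 0 by norm_num)
      have h3 := intervalIntegrable_sub_rpow_mul_rpow hρ hx
        (show (-1 : ℝ) < -(2 * (1 / 4)) by norm_num)
      refine (((h1.add (h2.const_mul 2)).add h3).const_mul 4).congr fun t _ => ?_
      ring)
    (Eventually.of_forall fun t ht s _ => by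
      rw [Set.uIoc_of_le hx.le] at ht
      exact (Real.hasStrictDerivAt_const_rpow ht.1 s).hasDerivAt.const_mul _)).2
  simpa using key

/-- For `ρ > 0` and `x > 0`, the Riemann–Liouville fractional integral of `log` based at `0`
equals the limit as `ε → 0⁺` of `(1/ε)(Γ(1+ε) x^{ρ+ε}/Γ(1+ε+ρ) − x^ρ/Γ(1+ρ))`. -/
theorem riemannLiouville_integral_log_eq_lim (ρ x : ℝ) (hρ : 0 < ρ) (hx : 0 < x) :
    Tendsto
      (fun ε : ℝ => (1 / ε) *
        (Real.Gamma (1 + ε) * x ^ (ρ + ε) / Real.Gamma (1 + ε + ρ) -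
          x ^ ρ / Real.Gamma (1 + ρ)))
      (nhdsWithin 0 (Set.Ioi 0))
      (nhds ((1 / Real.Gamma ρ) * ∫ t in (0 : ℝ)..x, (x - t) ^ (ρ - 1) * Real.log t)) := by
  have hslope := ((hasDerivAt_integral_sub_rpow_mul_rpow hρ hx).tendsto_slope_zero_right).const_mul
    (1 / Real.Gamma ρ)
  refine hslope.congr' ?_
  filter_upwards [self_mem_nhdsWithin] with ε hε
  have hε : 0 < ε := hε
  have hΓ := (Real.Gamma_pos_of_pos hρ).ne'
  rw [zero_add, integral_sub_rpow_mul_rpow hρ hx (by linarith : -1 < ε),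
    integral_sub_rpow_mul_rpow hρ hx (by norm_num : (-1 : ℝ) < 0), smul_eq_mul, ← mul_sub]
  simp only [add_zero, Real.Gamma_one, one_mul]
  field_simp
end

section
/- For all reals ρ > 0 and x > 0, the Riemann–Liouville fractional integral of order ρ of the logarithm based at 0 satisfies (1/Γ(ρ)) ∫₀ˣ (x−t)^{ρ−1} log t dt = (x^ρ/Γ(1+ρ)) · ( log x − ψ(1+ρ) − γ ), where ψ(1+ρ) = Γ'(1+ρ)/Γ(1+ρ) and γ = −Γ'(1). In particular, the quantity h(ρ) := log x − (Γ(1+ρ)/x^ρ) ∫₀ˣ log t (dt)^ρ is independent of x and equals ψ(1+ρ) + γ, giving the analytic extension of the finite harmonic series to real order ρ. -/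
open MeasureTheory Set Filter Topology

/-- The Mellin transform of the Riemann–Liouville kernel `t ↦ (x - t) ^ (ρ - 1)` on `(0, x]`. -/
lemma mellin_indicator_sub_rpow {ρ x s : ℝ} (hρ : 0 < ρ) (hx : 0 < x) (hs : 0 < s) :
    mellin ((Ioc 0 x).indicator fun t : ℝ ↦ (((x - t) ^ (ρ - 1) : ℝ) : ℂ)) s =
      ((x ^ (s + ρ - 1) * (Real.Gamma s * Real.Gamma ρ / Real.Gamma (s + ρ)) : ℝ) : ℂ) := by
  have hbeta := Complex.betaIntegral_scaled s ρ hx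
  rw [Complex.betaIntegral_eq_Gamma_mul_div _ _ (by simpa) (by simpa)] at hbeta
  have hmellin : mellin ((Ioc 0 x).indicator fun t : ℝ ↦ (((x - t) ^ (ρ - 1) : ℝ) : ℂ)) s =
      ∫ t in (0 : ℝ)..x, (t : ℂ) ^ ((s : ℂ) - 1) * ((x : ℂ) - t) ^ ((ρ : ℂ) - 1) := by
    rw [mellin, intervalIntegral.integral_of_le hx.le]
    simp_rw [← indicator_smul]
    rw [setIntegral_indicator measurableSet_Ioc,
      inter_eq_right.mpr Ioc_subset_Ioi_self]
    refine setIntegral_congr_fun measurableSet_Ioc fun t ht ↦ ?_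
    simp [Complex.ofReal_cpow (sub_nonneg.mpr ht.2)]
  rw [hmellin, hbeta]
  push_cast [Complex.ofReal_cpow hx.le, ← Complex.Gamma_ofReal]
  rfl

/-- Differentiating the Mellin transform of the Riemann–Liouville kernel at `1` inserts a
logarithm. -/
lemma hasDerivAt_mellin_indicator_sub_rpow {ρ x : ℝ} (hρ : 0 < ρ) (hx : 0 < x) :
    HasDerivAt (mellin ((Ioc 0 x).indicator fun t : ℝ ↦ (((x - t) ^ (ρ - 1) : ℝ) : ℂ)))
      ((∫ t in (0 : ℝ)..x, (x - t) ^ (ρ - 1) * Real.log t : ℝ) : ℂ) ((1 : ℝ) : ℂ) := by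
  set f := (Ioc 0 x).indicator fun t : ℝ ↦ (((x - t) ^ (ρ - 1) : ℝ) : ℂ) with hf
  have hint : IntervalIntegrable (fun t : ℝ ↦ (x - t) ^ (ρ - 1)) volume 0 x := by
    have h := (intervalIntegral.intervalIntegrable_rpow' (a := 0) (b := x)
      (show -1 < ρ - 1 by linarith)).comp_sub_left x
    simpa using h.symm
  have hfint : Integrable f := by
    rw [hf, integrable_indicator_iff measurableSet_Ioc]
    exact ((intervalIntegrable_iff_integrableOn_Ioc_of_le hx.le).mp hint).ofReal
  have htop : f =O[atTop] fun t : ℝ ↦ t ^ (-2 : ℝ) := by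
    refine Asymptotics.IsBigO.congr' (Asymptotics.isBigO_zero _ _) ?_ EventuallyEq.rfl
    filter_upwards [eventually_gt_atTop x] with t ht
    simp [hf, ht]
  have hzero : f =O[𝓝[>] 0] fun t : ℝ ↦ t ^ (-0 : ℝ) := by
    have hc : ContinuousAt (fun t : ℝ ↦ (((x - t) ^ (ρ - 1) : ℝ) : ℂ)) 0 := by
      refine Complex.continuous_ofReal.continuousAt.comp ?_
      exact ContinuousAt.rpow_const (by fun_prop) (Or.inl (by simpa using hx.ne'))
    have hO := (hc.isBigO_one ℝ).mono (nhdsWithin_le_nhds (s := Ioi 0))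
    refine Asymptotics.IsBigO.congr' hO ?_ (by simp)
    filter_upwards [Ioc_mem_nhdsGT hx] with t ht
    simp only [hf, indicator_of_mem ht]
  have hderiv := (mellin_hasDerivAt_of_isBigO_rpow (s := ((1 : ℝ) : ℂ))
    (hfint.locallyIntegrable.locallyIntegrableOn _) htop (by norm_num) hzero (by norm_num)).2
  convert! hderiv using 1
  rw [mellin, intervalIntegral.integral_of_le hx.le, ← integral_complex_ofReal,
    ← inter_eq_right.mpr (Ioc_subset_Ioi_self : Ioc 0 x ⊆ Ioi 0),
    ← setIntegral_indicator measurableSet_Ioc]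
  refine setIntegral_congr_fun measurableSet_Ioi fun t _ ↦ ?_
  by_cases ht : t ∈ Ioc 0 x <;> simp [hf, ht, mul_comm]

lemma hasDerivAt_rpow_mul_Gamma_div {ρ x : ℝ} (hρ : 0 < ρ) (hx : 0 < x) :
    HasDerivAt
      (fun s ↦ x ^ (s + ρ - 1) * (Real.Gamma s * Real.Gamma ρ / Real.Gamma (s + ρ)))
      (x ^ ρ * Real.Gamma ρ / Real.Gamma (1 + ρ) *
        (Real.log x - deriv Real.Gamma (1 + ρ) / Real.Gamma (1 + ρ) - (-(deriv Real.Gamma 1)))) 1 := by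
  have hdiff : ∀ {s : ℝ}, 0 < s → HasDerivAt Real.Gamma (deriv Real.Gamma s) s := fun {s} hs ↦
    (Real.differentiableAt_Gamma fun m ↦ by
      have : (0 : ℝ) ≤ m := m.cast_nonneg
      linarith).hasDerivAt
  have hpos : 0 < Real.Gamma (1 + ρ) := Real.Gamma_pos_of_pos (by linarith)
  have hpow := (((hasDerivAt_id (1 : ℝ)).add_const ρ).sub_const 1).const_rpow hx
  have hquot := ((hdiff one_pos).mul_const (Real.Gamma ρ)).div
    ((hdiff (by linarith : 0 < 1 + ρ)).comp_add_const 1 ρ) hpos.ne'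
  convert! hpow.mul hquot using 1
  simp only [id, Pi.div_apply, Real.Gamma_one, add_sub_cancel_left]
  field_simp
  ring

/-- For `ρ > 0` and `x > 0`, the Riemann–Liouville fractional integral of `log` based at `0`
satisfies `(1/Γ(ρ)) ∫₀ˣ (x−t)^{ρ−1} log t dt = (x^ρ/Γ(1+ρ))(log x − ψ(1+ρ) − γ)`, where
`ψ(1+ρ) = Γ'(1+ρ)/Γ(1+ρ)` and `γ = −Γ'(1)`.  In particular
`h(ρ) := log x − (Γ(1+ρ)/x^ρ) ∫₀ˣ log t (dt)^ρ` is independent of `x` and equals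
`ψ(1+ρ) + γ`, the analytic extension of the finite harmonic series. -/
theorem riemannLiouville_integral_log (ρ x : ℝ) (hρ : 0 < ρ) (hx : 0 < x) :
    (1 / Real.Gamma ρ) * (∫ t in (0 : ℝ)..x, (x - t) ^ (ρ - 1) * Real.log t) =
      (x ^ ρ / Real.Gamma (1 + ρ)) *
        (Real.log x - deriv Real.Gamma (1 + ρ) / Real.Gamma (1 + ρ) - (-(deriv Real.Gamma 1))) ∧
    Real.log x -
        (Real.Gamma (1 + ρ) / x ^ ρ) *
          ((1 / Real.Gamma ρ) * ∫ t in (0 : ℝ)..x, (x - t) ^ (ρ - 1) * Real.log t) =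
      deriv Real.Gamma (1 + ρ) / Real.Gamma (1 + ρ) + (-(deriv Real.Gamma 1)) := by
  have hpos : 0 < Real.Gamma ρ := Real.Gamma_pos_of_pos hρ
  have hpos' : 0 < Real.Gamma (1 + ρ) := Real.Gamma_pos_of_pos (by linarith)
  have hxρ : 0 < x ^ ρ := Real.rpow_pos_of_pos hx ρ
  have hintegral : ∫ t in (0 : ℝ)..x, (x - t) ^ (ρ - 1) * Real.log t =
      x ^ ρ * Real.Gamma ρ / Real.Gamma (1 + ρ) *
        (Real.log x - deriv Real.Gamma (1 + ρ) / Real.Gamma (1 + ρ) -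
          (-(deriv Real.Gamma 1))) := by
    refine Complex.ofReal_injective
      ((hasDerivAt_mellin_indicator_sub_rpow hρ hx).comp_ofReal.unique ?_)
    refine (hasDerivAt_rpow_mul_Gamma_div hρ hx).ofReal_comp.congr_of_eventuallyEq ?_
    filter_upwards [lt_mem_nhds one_pos] with s hs
    exact mellin_indicator_sub_rpow hρ hx hs
  rw [hintegral]
  constructor
  · field_simp
  · field_simp
    ring
end

section
/- Let σ be a real number with 0 < σ < 1, and define F(y) = (1/Γ(1−σ)) ∫₀ʸ (y−t)^{−σ} log t dt for y > 0. Then for every x > 0, the Riemann–Liouville fractional derivative of order σ of the logarithm satisfies F'(x) = (x^{−σ}/Γ(1−σ)) · ( log x − ψ(1−σ) − γ ), where ψ(1−σ) = Γ'(1−σ)/Γ(1−σ) and γ = −Γ'(1). -/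
theorem ofReal_rpow_mul_one_sub_rpow {x : ℝ} (hx : x ∈ Set.uIoc (0 : ℝ) 1) (u v : ℝ) :
    ((x ^ (u - 1) * (1 - x) ^ (v - 1) : ℝ) : ℂ) =
      (x : ℂ) ^ ((u : ℂ) - 1) * (1 - (x : ℂ)) ^ ((v : ℂ) - 1) := by
  rw [Set.uIoc_of_le zero_le_one] at hx
  rw [Complex.ofReal_mul, Complex.ofReal_cpow hx.1.le, Complex.ofReal_cpow (sub_nonneg.2 hx.2)]
  push_cast
  rfl

theorem intervalIntegrable_rpow_mul_one_sub_rpow {u v : ℝ} (hu : 0 < u) (hv : 0 < v) :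
    IntervalIntegrable (fun x : ℝ => x ^ (u - 1) * (1 - x) ^ (v - 1)) MeasureTheory.volume 0 1 := by
  have h := Complex.betaIntegral_convergent (u := u) (v := v) (by simpa) (by simpa)
  rw [intervalIntegrable_iff] at h ⊢
  refine MeasureTheory.IntegrableOn.congr_fun h.re (fun x hx => ?_) measurableSet_uIoc
  simp only [← ofReal_rpow_mul_one_sub_rpow hx]
  exact Complex.ofReal_re _

theorem integral_rpow_mul_one_sub_rpow {u v : ℝ} (hu : 0 < u) (hv : 0 < v) :
    ∫ x in (0 : ℝ)..1, x ^ (u - 1) * (1 - x) ^ (v - 1) =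
      Real.Gamma u * Real.Gamma v / Real.Gamma (u + v) := by
  have h := ProbabilityTheory.beta_eq_betaIntegralReal u v hu hv
  rw [ProbabilityTheory.beta] at h
  rw [h, Complex.betaIntegral, ← Complex.ofReal_re (∫ x in (0 : ℝ)..1, _),
    ← intervalIntegral.integral_ofReal]
  congr 1
  refine intervalIntegral.integral_congr_ae (Filter.Eventually.of_forall fun x hx => ?_)
  exact ofReal_rpow_mul_one_sub_rpow hx u v

/-- Differentiating Euler's beta integral in its first parameter at `1`. -/
theorem intervalIntegrable_and_hasDerivAt_beta_one {v : ℝ} (hv : 0 < v) :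
    IntervalIntegrable (fun t : ℝ => Real.log t * (1 - t) ^ (v - 1)) MeasureTheory.volume 0 1 ∧
    HasDerivAt (fun s : ℝ => ∫ t in (0 : ℝ)..1, t ^ (s - 1) * (1 - t) ^ (v - 1))
      (∫ t in (0 : ℝ)..1, Real.log t * (1 - t) ^ (v - 1)) 1 := by
  have key := intervalIntegral.hasDerivAt_integral_of_dominated_loc_of_deriv_le
    (μ := MeasureTheory.volume) (a := 0) (b := 1) (x₀ := (1 : ℝ)) (s := Set.Ioi (1 / 2 : ℝ))
    (F := fun s t : ℝ => t ^ (s - 1) * (1 - t) ^ (v - 1))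
    (F' := fun s t : ℝ => t ^ (s - 1) * Real.log t * (1 - t) ^ (v - 1))
    (bound := fun t : ℝ => 4 * (t ^ ((1 / 4 : ℝ) - 1) * (1 - t) ^ (v - 1)))
    (Ioi_mem_nhds (by norm_num)) ?_ ?_ ?_ ?_ ?_ ?_
  · simpa using key
  · exact Filter.Eventually.of_forall fun s =>
      (by fun_prop : Measurable fun t : ℝ => t ^ (s - 1) * (1 - t) ^ (v - 1)).aestronglyMeasurable
  · exact intervalIntegrable_rpow_mul_one_sub_rpow one_pos hv
  · exact (by fun_prop : Measurable fun t : ℝ =>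
      t ^ ((1 : ℝ) - 1) * Real.log t * (1 - t) ^ (v - 1)).aestronglyMeasurable
  · refine Filter.Eventually.of_forall fun t ht s hs => ?_
    rw [Set.uIoc_of_le zero_le_one] at ht
    rw [Set.mem_Ioi] at hs
    have h1 : 0 ≤ (1 - t) ^ (v - 1) := Real.rpow_nonneg (sub_nonneg.2 ht.2) _
    have h2 := Real.abs_log_mul_self_rpow_lt t (s - 1 / 4) ht.1 ht.2 (by linarith)
    have h3 : 1 / (s - 1 / 4) ≤ 4 := by
      rw [div_le_iff₀ (by linarith)]; linarith
    have h4 : t ^ (s - 1) = t ^ (s - 1 / 4) * t ^ ((1 / 4 : ℝ) - 1) := by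
      rw [← Real.rpow_add ht.1]; ring_nf
    have h5 : 0 ≤ t ^ ((1 / 4 : ℝ) - 1) := Real.rpow_nonneg ht.1.le _
    calc ‖t ^ (s - 1) * Real.log t * (1 - t) ^ (v - 1)‖
        = |Real.log t * t ^ (s - 1 / 4)| * (t ^ ((1 / 4 : ℝ) - 1) * (1 - t) ^ (v - 1)) := by
          rw [h4, ← abs_of_nonneg (mul_nonneg h5 h1), ← abs_mul, Real.norm_eq_abs]
          congr 1
          ring
      _ ≤ _ := mul_le_mul_of_nonneg_right (h2.le.trans h3) (mul_nonneg h5 h1)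
  · exact (intervalIntegrable_rpow_mul_one_sub_rpow (by norm_num) hv).const_mul 4
  · refine Filter.Eventually.of_forall fun t ht s _ => ?_
    rw [Set.uIoc_of_le zero_le_one] at ht
    have h := ((hasDerivAt_id s).sub_const 1).const_rpow ht.1
    simpa [mul_comm (t ^ (s - 1))] using h.mul_const ((1 - t) ^ (v - 1))

theorem Real.hasDerivAt_Gamma_of_pos {s : ℝ} (hs : 0 < s) :
    HasDerivAt Real.Gamma (deriv Real.Gamma s) s :=
  (Real.differentiableAt_Gamma fun m => by
    have : (0 : ℝ) ≤ m := m.cast_nonneg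
    linarith).hasDerivAt

theorem Real.deriv_Gamma_add_one {s : ℝ} (hs : 0 < s) :
    deriv Real.Gamma (s + 1) = Real.Gamma s + s * deriv Real.Gamma s := by
  have h1 : HasDerivAt (fun x : ℝ => Real.Gamma (x + 1)) (deriv Real.Gamma (s + 1)) s :=
    (Real.hasDerivAt_Gamma_of_pos (by linarith : 0 < s + 1)).comp_add_const s 1
  have h2 : HasDerivAt (fun x : ℝ => x * Real.Gamma x)
      (1 * Real.Gamma s + s * deriv Real.Gamma s) s :=
    (hasDerivAt_id s).mul (Real.hasDerivAt_Gamma_of_pos hs)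
  have h3 : (fun x : ℝ => Real.Gamma (x + 1)) =ᶠ[nhds s] fun x => x * Real.Gamma x := by
    filter_upwards [lt_mem_nhds hs] with x hx using Real.Gamma_add_one hx.ne'
  rw [h1.unique (h2.congr_of_eventuallyEq h3), one_mul]

theorem integral_log_mul_one_sub_rpow {v : ℝ} (hv : 0 < v) :
    ∫ t in (0 : ℝ)..1, Real.log t * (1 - t) ^ (v - 1) =
      (deriv Real.Gamma 1 - 1 / v - deriv Real.Gamma v / Real.Gamma v) / v := by
  have hG := (Real.Gamma_pos_of_pos hv).ne'
  have hG1 : Real.Gamma (1 + v) ≠ 0 := (Real.Gamma_pos_of_pos (by linarith)).ne'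
  have h1 := ((Real.hasDerivAt_Gamma_of_pos one_pos).mul_const (Real.Gamma v)).div
    ((Real.hasDerivAt_Gamma_of_pos (by linarith : 0 < 1 + v)).comp_add_const 1 v) hG1
  have h2 : (fun s : ℝ => ∫ t in (0 : ℝ)..1, t ^ (s - 1) * (1 - t) ^ (v - 1)) =ᶠ[nhds 1]
      fun s => Real.Gamma s * Real.Gamma v / Real.Gamma (s + v) := by
    filter_upwards [lt_mem_nhds one_pos] with s hs using integral_rpow_mul_one_sub_rpow hs hv
  rw [(intervalIntegrable_and_hasDerivAt_beta_one hv).2.unique (h1.congr_of_eventuallyEq h2),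
    add_comm 1 v, Real.deriv_Gamma_add_one hv, Real.Gamma_add_one hv.ne', Real.Gamma_one]
  field_simp
  ring

theorem integral_sub_rpow_mul_log {v y : ℝ} (hv : 0 < v) (hy : 0 < y) :
    ∫ t in (0 : ℝ)..y, (y - t) ^ (v - 1) * Real.log t =
      y ^ v * (Real.log y / v + ∫ t in (0 : ℝ)..1, Real.log t * (1 - t) ^ (v - 1)) := by
  have hint := (intervalIntegrable_and_hasDerivAt_beta_one hv).1
  have hint' : IntervalIntegrable (fun t : ℝ => (1 - t) ^ (v - 1)) MeasureTheory.volume 0 1 := by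
    simpa using intervalIntegrable_rpow_mul_one_sub_rpow one_pos hv
  have hI : ∫ t in (0 : ℝ)..1, (1 - t) ^ (v - 1) = 1 / v := by
    have h := integral_rpow_mul_one_sub_rpow one_pos hv
    have hG := (Real.Gamma_pos_of_pos hv).ne'
    rw [add_comm, Real.Gamma_add_one hv.ne', Real.Gamma_one] at h
    simp only [sub_self, Real.rpow_zero, one_mul] at h
    rw [h]
    field_simp
  have hscale := intervalIntegral.mul_integral_comp_mul_left (a := 0) (b := 1) (c := y)
    (f := fun t : ℝ => (y - t) ^ (v - 1) * Real.log t)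
  rw [mul_zero, mul_one] at hscale
  rw [← hscale, div_eq_mul_one_div, ← hI, ← intervalIntegral.integral_const_mul (Real.log y),
    ← intervalIntegral.integral_add (hint'.const_mul _) hint,
    ← intervalIntegral.integral_const_mul, ← intervalIntegral.integral_const_mul]
  refine intervalIntegral.integral_congr_ae (Filter.Eventually.of_forall fun t ht => ?_)
  rw [Set.uIoc_of_le zero_le_one] at ht
  have h1 : y - y * t = y * (1 - t) := by ring
  rw [h1, Real.mul_rpow hy.le (sub_nonneg.2 ht.2), Real.log_mul hy.ne' ht.1.ne',
    Real.rpow_sub_one hy.ne']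
  field_simp


/-- For `0 < σ < 1`, the Riemann–Liouville fractional derivative of order `σ` of `log`
based at `0`, namely the derivative of `F y = (1/Γ(1−σ)) ∫₀ʸ (y−t)^{−σ} log t dt`, satisfies
`F'(x) = (x^{−σ}/Γ(1−σ))(log x − ψ(1−σ) − γ)` for `x > 0`, where
`ψ(1−σ) = Γ'(1−σ)/Γ(1−σ)` and `γ = −Γ'(1)`. -/
theorem riemannLiouville_deriv_log (σ : ℝ) (hσ0 : 0 < σ) (hσ1 : σ < 1) (x : ℝ) (hx : 0 < x) :
    deriv (fun y : ℝ =>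
        (1 / Real.Gamma (1 - σ)) * ∫ t in (0 : ℝ)..y, (y - t) ^ (-σ) * Real.log t) x =
      (x ^ (-σ) / Real.Gamma (1 - σ)) *
        (Real.log x - deriv Real.Gamma (1 - σ) / Real.Gamma (1 - σ) -
          (-(deriv Real.Gamma 1))) := by
  have hv : 0 < 1 - σ := sub_pos.2 hσ1
  have hσ : -σ = (1 - σ) - 1 := by ring
  rw [deriv_const_mul_field, hσ]
  generalize 1 - σ = v at hv
  have h1 : (fun y : ℝ => ∫ t in (0 : ℝ)..y, (y - t) ^ (v - 1) * Real.log t) =ᶠ[nhds x]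
      fun y => y ^ v * (Real.log y / v + ∫ t in (0 : ℝ)..1, Real.log t * (1 - t) ^ (v - 1)) := by
    filter_upwards [lt_mem_nhds hx] with y hy using integral_sub_rpow_mul_log hv hy
  have h2 := (Real.hasDerivAt_rpow_const (p := v) (Or.inl hx.ne')).mul
    (((Real.hasDerivAt_log hx.ne').div_const v).add_const
      (∫ t in (0 : ℝ)..1, Real.log t * (1 - t) ^ (v - 1)))
  rw [(h2.congr_of_eventuallyEq h1).deriv, integral_log_mul_one_sub_rpow hv,
    Real.rpow_sub_one hx.ne']
  have hG := (Real.Gamma_pos_of_pos hv).ne'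
  field_simp
  ring
end
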